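/- arXiv:1510.08812 — 5 statements merged into one kernel-verified Lean document; each statement's English description precedes it below -/
import Mathlib

section
/- Let m ≥ 3 and let D be a real m×m matrix satisfying Dᵀ J_{1,m−1} + J_{1,m−1} D = 0 (i.e. D ∈ so(1,m−1)). If D is diagonalizable over ℝ, with eigenvalues λ₁, …, λ_m listed with multiplicity, then after a permutation of the indices one has λ₁ = −λ₂ and λ₃ = ⋯ = λ_m = 0. -/
open Matrix

/-- The diagonal matrix `J_{1,m-1} = diag(-1, 1, …, 1)` of the standard Lorentzian
quadratic form of signature `(1, m-1)` on `ℝ^m`. -/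
noncomputable def minkMatrix (m : ℕ) : Matrix (Fin m) (Fin m) ℝ :=
  Matrix.diagonal (fun i => if (i : ℕ) = 0 then (-1 : ℝ) else 1)

theorem aux_null (m : ℕ) (z : Fin m) (hz : (z : ℕ) = 0) (v : Fin m → ℝ) (h0 : v z = 0)
    (h : v ⬝ᵥ (minkMatrix m *ᵥ v) = 0) : v = 0 := by
  have h2 : ∑ k, v k * v k = 0 := by
    rw [← h]
    simp only [dotProduct, minkMatrix, Matrix.mulVec_diagonal]
    refine Finset.sum_congr rfl fun k _ => ?_
    by_cases hk : (k : ℕ) = 0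
    · have : k = z := Fin.ext (hk.trans hz.symm)
      rw [this, h0]; simp
    · simp [hk]
  rw [Finset.sum_eq_zero_iff_of_nonneg (fun k _ => mul_self_nonneg _)] at h2
  funext k
  exact mul_self_eq_zero.mp (h2 k (Finset.mem_univ k))

theorem aux_null2 (m : ℕ) (z : Fin m) (hz : (z : ℕ) = 0) (P : Matrix (Fin m) (Fin m) ℝ) (hP : IsUnit P.det)
    (w : Fin m → ℝ) (h0 : (P *ᵥ w) z = 0)
    (h : w ⬝ᵥ ((Pᵀ * minkMatrix m * P) *ᵥ w) = 0) : w = 0 := by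
  have h1 : P *ᵥ w = 0 := by
    apply aux_null m z hz _ h0
    rw [← h, ← Matrix.mulVec_mulVec, ← Matrix.mulVec_mulVec, Matrix.dotProduct_mulVec w,
      Matrix.vecMul_transpose]
  exact Matrix.eq_zero_of_mulVec_eq_zero hP.ne_zero h1

theorem aux_pair (m : ℕ) (z : Fin m) (hz : (z : ℕ) = 0) (P : Matrix (Fin m) (Fin m) ℝ) (hP : IsUnit P.det)
    (i j : Fin m) (hij : i ≠ j)
    (hii : (Pᵀ * minkMatrix m * P) i i = 0) (hjj : (Pᵀ * minkMatrix m * P) j j = 0)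
    (h1 : (Pᵀ * minkMatrix m * P) i j = 0) (h2 : (Pᵀ * minkMatrix m * P) j i = 0) : False := by
  have key : ∀ a b : ℝ, a * P z i + b * P z j = 0 → a = 0 ∧ b = 0 := by
    intro a b hab
    have := aux_null2 m z hz P hP (a • Pi.single i 1 + b • Pi.single j 1)
      (by simpa [Matrix.mulVec_add, Matrix.mulVec_smul] using hab)
      (by simp [Matrix.mulVec_add, Matrix.mulVec_smul, hii, hjj, h1, h2])
    have e1 := congrFun this i
    have e2 := congrFun this j
    simp [hij, hij.symm] at e1 e2
    exact ⟨e1, e2⟩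
  obtain ⟨hc, -⟩ := key (P z j) (-P z i) (by ring)
  have := (key 0 1 (by rw [hc]; ring)).2
  norm_num at this

/-- If `D ∈ so(1, m-1)`, `m ≥ 3`, is diagonalizable over `ℝ` with eigenvalues
`λ₁, …, λ_m` (with multiplicity), then after a permutation of the indices,
`λ₁ = -λ₂` and `λ₃ = ⋯ = λ_m = 0`. -/
theorem so1_split_eigenvalues (m : ℕ) (hm : 3 ≤ m)
    (D : Matrix (Fin m) (Fin m) ℝ)
    (hD : Dᵀ * minkMatrix m + minkMatrix m * D = 0)
    (lam : Fin m → ℝ) (P : Matrix (Fin m) (Fin m) ℝ) (hP : IsUnit P.det)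
    (hdiag : D = P * Matrix.diagonal lam * P⁻¹) :
    ∃ σ : Equiv.Perm (Fin m),
      lam (σ ⟨0, by omega⟩) = - lam (σ ⟨1, by omega⟩) ∧
      ∀ i : Fin m, 2 ≤ (i : ℕ) → lam (σ i) = 0 := by
  have hdet : P * P⁻¹ = 1 := Matrix.mul_nonsing_inv P hP
  have hdet' : P⁻¹ * P = 1 := Matrix.nonsing_inv_mul P hP
  have hDP : D * P = P * Matrix.diagonal lam := by
    rw [hdiag, Matrix.mul_assoc, hdet', Matrix.mul_one]
  have hDP' : Pᵀ * Dᵀ = Matrix.diagonal lam * Pᵀ := by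
    rw [← Matrix.transpose_mul, hDP, Matrix.transpose_mul, Matrix.diagonal_transpose]
  have hS : Matrix.diagonal lam * (Pᵀ * minkMatrix m * P)
      + (Pᵀ * minkMatrix m * P) * Matrix.diagonal lam = 0 := by
    have : Pᵀ * (Dᵀ * minkMatrix m + minkMatrix m * D) * P = 0 := by rw [hD]; simp
    rw [← this, Matrix.mul_add, Matrix.add_mul]
    congr 1
    · rw [← Matrix.mul_assoc Pᵀ, hDP']; simp only [Matrix.mul_assoc]
    · simp only [Matrix.mul_assoc, hDP]
  have hS' : ∀ i j, (lam i + lam j) * (Pᵀ * minkMatrix m * P) i j = 0 := by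
    intro i j
    have := congrFun (congrFun hS i) j
    rw [Matrix.add_apply, Matrix.diagonal_mul, Matrix.mul_diagonal, Matrix.zero_apply] at this
    linarith
  have hpos : ∀ i j, i ≠ j → 0 < lam i * lam j → False := by
    intro i j hij h
    have hi : lam i ≠ 0 := left_ne_zero_of_mul h.ne'
    have hj : lam j ≠ 0 := right_ne_zero_of_mul h.ne'
    have hs : lam i + lam j ≠ 0 := by
      intro h0
      have : lam i = - lam j := by linarith
      rw [this] at h
      nlinarith [mul_self_nonneg (lam j)]
    have hs' : lam j + lam i ≠ 0 := by rwa [add_comm]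
    refine aux_pair m ⟨0, by omega⟩ rfl P hP i j hij ?_ ?_ ?_ ?_
    · exact (mul_eq_zero.mp (hS' i i)).resolve_left (by intro h; apply hi; linarith)
    · exact (mul_eq_zero.mp (hS' j j)).resolve_left (by intro h; apply hj; linarith)
    · exact (mul_eq_zero.mp (hS' i j)).resolve_left hs
    · exact (mul_eq_zero.mp (hS' j i)).resolve_left hs'
  by_cases hall : ∀ i, lam i = 0
  · exact ⟨1, by simp [hall], fun i _ => hall _⟩
  push Not at hall
  obtain ⟨i, hi⟩ := hall
  have hJ : (minkMatrix m).det ≠ 0 := by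
    rw [minkMatrix, Matrix.det_diagonal, Finset.prod_ne_zero_iff]
    intro k _
    split_ifs <;> norm_num
  have hdS : (Pᵀ * minkMatrix m * P).det ≠ 0 := by
    rw [Matrix.det_mul, Matrix.det_mul, Matrix.det_transpose]
    exact mul_ne_zero (mul_ne_zero hP.ne_zero hJ) hP.ne_zero
  obtain ⟨j, hj⟩ : ∃ j, (Pᵀ * minkMatrix m * P) i j ≠ 0 := by
    by_contra! h
    exact hdS (Matrix.det_eq_zero_of_row_eq_zero i h)
  have hlj : lam i = - lam j := by
    have := (mul_eq_zero.mp (hS' i j)).resolve_right hj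
    linarith
  have hij : i ≠ j := by
    rintro rfl
    apply hi; linarith
  have hrest : ∀ k, k ≠ i → k ≠ j → lam k = 0 := by
    intro k hki hkj
    by_contra hk
    rcases lt_or_gt_of_ne (mul_ne_zero hk hi) with h | h
    · exact hpos k j hkj (by rw [hlj] at h; linarith)
    · exact hpos k i hki h
  let a : Fin m := ⟨0, by omega⟩
  let b : Fin m := ⟨1, by omega⟩
  have hab : a ≠ b := by simp [a, b]
  let τ : Equiv.Perm (Fin m) := Equiv.swap a i
  let σ : Equiv.Perm (Fin m) := Equiv.swap (τ b) j * τ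
  have hτ : τ a = i := Equiv.swap_apply_left a i
  have hσb : σ b = j := by simp [σ]
  have hσa : σ a = i := by
    simp only [σ, Equiv.Perm.mul_apply, hτ]
    refine Equiv.swap_apply_of_ne_of_ne ?_ hij
    rw [← hτ]
    exact fun h => hab (τ.injective h)
  refine ⟨σ, ?_, ?_⟩
  · change lam (σ a) = - lam (σ b)
    rw [hσa, hσb, hlj]
  · intro k hk
    apply hrest
    · rw [← hσa]
      intro h
      have := congrArg Fin.val (σ.injective h)
      simp [a] at this
      omega
    · rw [← hσb]
      intro h
      have := congrArg Fin.val (σ.injective h)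
      simp [b] at this
      omega
end

section
/- Let h = sl(2,ℝ) with basis (X, Y, Z) satisfying [X,Y] = Y, [X,Z] = −Z, [Y,Z] = X, and for t ∈ ℝ let a_t : h → h be the linear map with a_t X = X, a_t Y = e^t Y, a_t Z = e^{−t} Z (the adjoint action of exp(tX)). Let (V, g) be a real vector space of dimension n ≥ 3 with a Lorentzian symmetric bilinear form g, let ι : h → V be an injective linear map, and let q(u,v) := g(ι u, ι v) be the pulled-back symmetric bilinear form on h. Assume that for every t ∈ ℝ there exists c(t) > 0 such that q(a_t u, a_t v) = c(t) q(u, v) for all u, v ∈ h. Then c(t) = 1 for all t, q(Y,Y) = q(Z,Z) = 0, q(X,Y) = q(X,Z) = 0, and q(X,X) > 0. -/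
open Module

/-- A symmetric bilinear form on a finite-dimensional real vector space is *Lorentzian* if
some basis puts it in the form `diag(-1, 1, …, 1)`. -/
def IsLorentzian {V : Type*} [AddCommGroup V] [Module ℝ V]
    (B : LinearMap.BilinForm ℝ V) : Prop :=
  ∃ b : Basis (Fin (finrank ℝ V)) ℝ V,
    ∀ i j, B (b i) (b j) = if i = j then (if (i : ℕ) = 0 then (-1 : ℝ) else 1) else 0

theorem lor_aux {V : Type*} [AddCommGroup V] [Module ℝ V]
    (g : LinearMap.BilinForm ℝ V) (hsymm : g.IsSymm) (hg : IsLorentzian g)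
    (p q : V) (hpp : g p p ≤ 0) (hqq : g q q ≤ 0) (hpq : g p q = 0)
    (hli : ∀ s t : ℝ, s • p + t • q = 0 → s = 0 ∧ t = 0) (hn : 3 ≤ finrank ℝ V) : False := by
  obtain ⟨b, hb⟩ := hg
  let i0 : Fin (finrank ℝ V) := ⟨0, by omega⟩
  have key : ∀ v : V, b.repr v i0 = 0 → g v v ≤ 0 → v = 0 := by
    intro v h0 hv
    have hgv : g v v = ∑ i, (b.repr v i) ^ 2 := by
      conv_lhs => rw [← b.sum_repr v]
      simp only [map_sum, LinearMap.sum_apply, map_smul, LinearMap.smul_apply, smul_eq_mul, hb]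
      refine Finset.sum_congr rfl fun i _ => ?_
      rw [Finset.sum_eq_single i]
      · by_cases hi : (i : ℕ) = 0
        · have : i = i0 := Fin.ext hi
          subst this
          simp [h0]
        · simp [hi, sq]
      · intro j _ hj
        simp [hj, hj.symm]
      · simp
    have hz : ∑ i, (b.repr v i) ^ 2 = 0 :=
      le_antisymm (hgv ▸ hv) (Finset.sum_nonneg fun i _ => sq_nonneg _)
    rw [Finset.sum_eq_zero_iff_of_nonneg (fun i _ => sq_nonneg _)] at hz
    apply b.repr.injective
    ext i
    simpa using hz i (Finset.mem_univ i)
  have hqp : g q p = 0 := by rw [← hpq]; exact hsymm.eq q p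
  have h := key ((b.repr q i0) • p + (-(b.repr p i0)) • q) (by simp; ring) (by
    simp only [map_add, map_smul, LinearMap.add_apply, LinearMap.smul_apply, smul_eq_mul, hpq, hqp]
    nlinarith [mul_nonneg (sq_nonneg (b.repr q i0)) (neg_nonneg.2 hpp),
      mul_nonneg (sq_nonneg (b.repr p i0)) (neg_nonneg.2 hqq)])
  have h2 := (hli _ _ h).2
  have hp := key p (by linarith) hpp
  have := (hli 1 0 (by simp [hp])).1
  norm_num at this

/-- Let `x = ι X`, `y = ι Y`, `z = ι Z` be the images of an `sl(2)`-triple under an injective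
linear map `ι` into a Lorentzian space `(V, g)`, and suppose that the adjoint action
`a_t : X ↦ X, Y ↦ e^t Y, Z ↦ e^{-t} Z` of `exp(tX)` is conformal for the pulled-back form
`q(u,v) = g(ι u, ι v)`, with conformal factor `c t > 0`.  Then `c ≡ 1`, `Y` and `Z` are
`q`-isotropic and `q`-orthogonal to `X`, and `q(X,X) > 0`. -/
theorem conformal_adjoint_flow_structure {V : Type*} [AddCommGroup V] [Module ℝ V]
    [FiniteDimensional ℝ V] (hdim : 3 ≤ finrank ℝ V)
    (g : LinearMap.BilinForm ℝ V) (hsymm : g.IsSymm) (hg : IsLorentzian g)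
    (x y z : V) (hι : LinearIndependent ℝ ![x, y, z])
    (c : ℝ → ℝ) (hc : ∀ t, 0 < c t)
    (hconf : ∀ t a₁ a₂ a₃ b₁ b₂ b₃ : ℝ,
      g (a₁ • x + (Real.exp t * a₂) • y + (Real.exp (-t) * a₃) • z)
        (b₁ • x + (Real.exp t * b₂) • y + (Real.exp (-t) * b₃) • z)
      = c t * g (a₁ • x + a₂ • y + a₃ • z) (b₁ • x + b₂ • y + b₃ • z)) :
    (∀ t, c t = 1) ∧ g y y = 0 ∧ g z z = 0 ∧ g x y = 0 ∧ g x z = 0 ∧ 0 < g x x := by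
  have hli : ∀ r s t : ℝ, r • x + s • y + t • z = 0 → r = 0 ∧ s = 0 ∧ t = 0 := by
    intro r s t h
    have := Fintype.linearIndependent_iff.1 hι ![r, s, t] (by simpa [Fin.sum_univ_three] using h)
    exact ⟨this 0, this 1, this 2⟩
  have Nxy : g x x ≤ 0 → g y y ≤ 0 → g x y = 0 → False := fun h1 h2 h3 =>
    lor_aux g hsymm hg x y h1 h2 h3 (fun s t h => by
      have := hli s t 0 (by simpa using h)
      exact ⟨this.1, this.2.1⟩) hdim
  have Nxz : g x x ≤ 0 → g z z ≤ 0 → g x z = 0 → False := fun h1 h2 h3 =>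
    lor_aux g hsymm hg x z h1 h2 h3 (fun s t h => by
      have := hli s 0 t (by simpa using h)
      exact ⟨this.1, this.2.2⟩) hdim
  have exx : ∀ t, g x x = c t * g x x := fun t => by simpa using hconf t 1 0 0 1 0 0
  have exy : ∀ t, Real.exp t * g x y = c t * g x y := fun t => by
    simpa using hconf t 1 0 0 0 1 0
  have exz : ∀ t, Real.exp (-t) * g x z = c t * g x z := fun t => by
    simpa using hconf t 1 0 0 0 0 1
  have eyy : ∀ t, Real.exp t * (Real.exp t * g y y) = c t * g y y := fun t => by
    simpa using hconf t 0 1 0 0 1 0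
  have ezz : ∀ t, Real.exp (-t) * (Real.exp (-t) * g z z) = c t * g z z := fun t => by
    simpa using hconf t 0 0 1 0 0 1
  have cz : ∀ a k w : ℝ, a * w = k * w → w ≠ 0 → a = k := fun a k w h hw =>
    mul_right_cancel₀ hw h
  have hc1 : ∀ t, c t = 1 := by
    intro t
    by_contra hne
    have hxx : g x x = 0 := by
      by_contra h
      exact hne (cz 1 _ _ (by rw [one_mul]; exact exx t) h).symm
    have hE : Real.exp t * Real.exp (-t) = 1 := by rw [← Real.exp_add]; simp
    have p1 := Real.exp_pos t
    have p2 := Real.exp_pos (-t)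
    -- one of the pairs (yy, xy), (zz, xz) vanishes
    have A : (g y y ≠ 0 ∨ g x y ≠ 0) := by
      by_contra h
      push Not at h
      exact Nxy hxx.le h.1.le h.2
    have B : (g z z ≠ 0 ∨ g x z ≠ 0) := by
      by_contra h
      push Not at h
      exact Nxz hxx.le h.1.le h.2
    have A' : c t = Real.exp t * Real.exp t ∨ c t = Real.exp t := by
      rcases A with h | h
      · left; exact (cz _ _ _ (by rw [mul_assoc]; exact eyy t) h).symm
      · right; exact (cz _ _ _ (exy t) h).symm
    have B' : c t = Real.exp (-t) * Real.exp (-t) ∨ c t = Real.exp (-t) := by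
      rcases B with h | h
      · left; exact (cz _ _ _ (by rw [mul_assoc]; exact ezz t) h).symm
      · right; exact (cz _ _ _ (exz t) h).symm
    have ht : t ≠ 0 := by
      rintro rfl
      simp at A'
      exact hne A'
    rw [← Real.exp_add] at A' B'
    rcases A' with h | h <;> rcases B' with h' | h' <;>
      · rw [h] at h'
        have := Real.exp_injective h'
        exact ht (by linarith)
  have e1 : (1:ℝ) < Real.exp 1 := Real.one_lt_exp_iff.2 one_pos
  have e2 : Real.exp (-1) < 1 := Real.exp_lt_one_iff.2 (by norm_num)
  have e3 := Real.exp_pos (-1)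
  have hxy : g x y = 0 := by
    by_contra h
    have := cz _ _ _ (exy 1) h
    rw [hc1] at this; linarith
  have hxz : g x z = 0 := by
    by_contra h
    have := cz _ _ _ (exz 1) h
    rw [hc1] at this; linarith
  have hyy : g y y = 0 := by
    by_contra h
    have := cz _ _ _ ((mul_assoc _ _ _).trans (eyy 1)) h
    rw [hc1] at this; nlinarith
  have hzz : g z z = 0 := by
    by_contra h
    have := cz _ _ _ ((mul_assoc _ _ _).trans (ezz 1)) h
    rw [hc1] at this; nlinarith
  refine ⟨hc1, hyy, hzz, hxy, hxz, ?_⟩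
  by_contra h
  exact Nxy (not_lt.1 h) hyy.le hxy
end

section
/- Let (V, g) be a real vector space of dimension n ≥ 2 with a Lorentzian symmetric bilinear form g, and let x, z ∈ V be linearly independent. For t ∈ ℝ let u_t be the linear endomorphism of the plane W := span(x, z) determined by u_t x = x and u_t z = z + t x. Assume that for every t ∈ ℝ there exists c(t) > 0 such that g(u_t w, u_t w′) = c(t) g(w, w′) for all w, w′ ∈ W. Then g(x,x) = 0, g(x,z) = 0 and g(z,z) > 0; in particular the restriction of g to W is degenerate with kernel exactly ℝx. -/
open Module

theorem lor_pos {V : Type*} [AddCommGroup V] [Module ℝ V]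
    (g : LinearMap.BilinForm ℝ V) (e : Basis (Fin (finrank ℝ V)) ℝ V)
    (he : ∀ i j, g (e i) (e j) = if i = j then (if (i : ℕ) = 0 then (-1 : ℝ) else 1) else 0)
    (w : V) (hw : w ≠ 0) (h0 : ∀ i : Fin (finrank ℝ V), (i : ℕ) = 0 → e.repr w i = 0) :
    0 < g w w := by
  have h : g w w = ∑ i, (e.repr w i) ^ 2 := by
    conv_lhs => rw [← e.sum_repr w]
    simp only [map_sum, LinearMap.sum_apply, map_smul, LinearMap.smul_apply, smul_eq_mul, he]
    refine Finset.sum_congr rfl fun i _ => ?_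
    rw [Finset.sum_eq_single i]
    · by_cases hi : (i : ℕ) = 0
      · simp [h0 i hi]
      · simp [hi, sq]
    · intro j _ hj
      simp [hj, hj.symm]
    · simp
  rw [h]
  have hne : e.repr w ≠ 0 := by simpa using hw
  obtain ⟨i, hi⟩ := Finsupp.ne_iff.mp hne
  have hi' : e.repr w i ≠ 0 := by simpa using hi
  exact Finset.sum_pos' (fun j _ => sq_nonneg _) ⟨i, Finset.mem_univ _, by positivity⟩

/-- If `x, z` are linearly independent vectors of a Lorentzian space `(V, g)` and the
unipotent flow `u_t : x ↦ x, z ↦ z + t x` of the plane `W = span(x,z)` is conformal with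
factor `c t > 0`, then `g(x,x) = 0`, `g(x,z) = 0`, `g(z,z) > 0`; in particular the
restriction of `g` to `W` is degenerate with kernel exactly `ℝ x`. -/
theorem conformal_unipotent_plane_degenerate {V : Type*} [AddCommGroup V] [Module ℝ V]
    [FiniteDimensional ℝ V] (hdim : 2 ≤ finrank ℝ V)
    (g : LinearMap.BilinForm ℝ V) (hsymm : g.IsSymm) (hg : IsLorentzian g)
    (x z : V) (hli : LinearIndependent ℝ ![x, z])
    (c : ℝ → ℝ) (hc : ∀ t, 0 < c t)
    (hconf : ∀ t a b a' b' : ℝ,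
      g ((a + b * t) • x + b • z) ((a' + b' * t) • x + b' • z)
        = c t * g (a • x + b • z) (a' • x + b' • z)) :
    g x x = 0 ∧ g x z = 0 ∧ 0 < g z z ∧
      (Submodule.span ℝ {x, z}) ⊓
          LinearMap.BilinForm.orthogonal g.flip (Submodule.span ℝ {x, z})
        = Submodule.span ℝ {x} := by
  have hs : g z x = g x z := hsymm.eq z x
  have h1 := hconf 1 1 0 1 0
  have h2 := hconf 1 1 0 0 1
  have h3 := hconf 1 0 1 0 1
  simp [hs] at h1 h2 h3
  have hA : g x x = 0 := by
    by_contra hA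
    have hc1 : c 1 = 1 := by
      have : (c 1 - 1) * g x x = 0 := by linarith
      rcases mul_eq_zero.mp this with h | h
      · linarith
      · exact absurd h hA
    rw [hc1] at h2
    apply hA; linarith
  have hB : g x z = 0 := by
    by_contra hB
    have hc1 : c 1 = 1 := by
      have : (c 1 - 1) * g x z = 0 := by linarith
      rcases mul_eq_zero.mp this with h | h
      · linarith
      · exact absurd h hB
    rw [hc1] at h3
    apply hB; linarith
  rw [hB] at hs
  have hq : ∀ a b : ℝ, g (a • x + b • z) (a • x + b • z) = b ^ 2 * g z z := by
    intro a b
    simp [hA, hB, hs]; ring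
  have hli' := LinearIndependent.pair_iff.mp hli
  have hC : 0 < g z z := by
    obtain ⟨e, he⟩ := hg
    by_contra hC
    have key : ∀ a b : ℝ, (∀ i : Fin (finrank ℝ V), (i : ℕ) = 0 →
        e.repr (a • x + b • z) i = 0) → a = 0 ∧ b = 0 := by
      intro a b h0
      by_contra hab
      have := lor_pos g e he (a • x + b • z) (fun h => hab (hli' a b h)) h0
      rw [hq] at this
      nlinarith [sq_nonneg b]
    let o : Fin (finrank ℝ V) := ⟨0, by omega⟩
    have ho : ∀ i : Fin (finrank ℝ V), (i : ℕ) = 0 → i = o := fun i hi => Fin.ext hi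
    have k1 := key (e.repr z o) (-(e.repr x o)) (by
      intro i hi
      rw [ho i hi]
      simp; ring)
    have k2 := key 1 0 (by
      intro i hi
      rw [ho i hi]
      have := k1.2
      simp at this
      simp [this])
    exact one_ne_zero k2.1
  refine ⟨hA, hB, hC, ?_⟩
  ext w
  simp only [Submodule.mem_inf, LinearMap.BilinForm.mem_orthogonal_iff,
    Submodule.mem_span_singleton, Submodule.mem_span_pair, LinearMap.BilinForm.isOrtho_def,
    LinearMap.flip_apply]
  constructor
  · rintro ⟨⟨a, b, rfl⟩, h⟩
    have := h z ⟨0, 1, by simp⟩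
    simp [hB, hC.ne'] at this
    exact ⟨a, by simp [this]⟩
  · rintro ⟨a, rfl⟩
    refine ⟨⟨a, 0, by simp⟩, ?_⟩
    rintro n ⟨p, q, rfl⟩
    simp [hA, hB]
end

section
/- Let (V, g) be a real vector space of dimension n ≥ 4 with a Lorentzian symmetric bilinear form g, and let W : V×V×V → V be an algebraic Weyl-type tensor. Suppose H and H′ are two distinct degenerate hyperplanes of V such that W(u,v,w) = 0 for all u,v,w ∈ H, the image of W is contained in H, W(u,v,w) = 0 for all u,v,w ∈ H′, and the image of W is contained in H′. Then W = 0. -/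
open Module

theorem lor_repr {V : Type*} [AddCommGroup V] [Module ℝ V]
    (g : LinearMap.BilinForm ℝ V) (b : Basis (Fin (finrank ℝ V)) ℝ V)
    (hb : ∀ i j, g (b i) (b j) = if i = j then (if (i : ℕ) = 0 then (-1 : ℝ) else 1) else 0)
    (x : V) (j : Fin (finrank ℝ V)) :
    g x (b j) = b.repr x j * (if (j : ℕ) = 0 then (-1 : ℝ) else 1) := by
  conv_lhs => rw [← b.sum_repr x]
  simp only [map_sum, map_smul, LinearMap.sum_apply, LinearMap.smul_apply, hb, smul_eq_mul]
  rw [Finset.sum_eq_single j]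
  · simp
  · intro i _ hij
    simp [hij]
  · simp

theorem lor_nondeg {V : Type*} [AddCommGroup V] [Module ℝ V]
    (g : LinearMap.BilinForm ℝ V) (hg : IsLorentzian g) (x : V) (hx : ∀ t, g x t = 0) :
    x = 0 := by
  obtain ⟨b, hb⟩ := hg
  apply b.ext_elem
  intro i
  have h := lor_repr g b hb x i
  rw [hx] at h
  split_ifs at h <;> simp <;> linarith

theorem lor_iso {V : Type*} [AddCommGroup V] [Module ℝ V]
    (g : LinearMap.BilinForm ℝ V) (b : Basis (Fin (finrank ℝ V)) ℝ V)
    (hb : ∀ i j, g (b i) (b j) = if i = j then (if (i : ℕ) = 0 then (-1 : ℝ) else 1) else 0)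
    (x : V) (hx : g x x = 0) (h0 : ∀ i : Fin (finrank ℝ V), (i : ℕ) = 0 → b.repr x i = 0) :
    x = 0 := by
  have h : g x x = ∑ i, b.repr x i * b.repr x i := by
    conv_lhs => rw [← b.sum_repr x]
    rw [b.sum_repr x, ← b.sum_repr x]
    rw [map_sum]
    refine Finset.sum_congr rfl fun i _ => ?_
    rw [b.sum_repr x, map_smul, lor_repr g b hb, smul_eq_mul]
    by_cases hi : (i : ℕ) = 0
    · simp [h0 i hi]
    · simp [hi]
  rw [hx] at h
  have h2 := (Finset.sum_eq_zero_iff_of_nonneg (fun i _ => mul_self_nonneg (b.repr x i))).1 h.symm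
  apply b.ext_elem
  intro i
  simpa using h2 i (Finset.mem_univ i)

theorem hyp_eq_ker {V : Type*} [AddCommGroup V] [Module ℝ V] [FiniteDimensional ℝ V]
    (hdim : 4 ≤ finrank ℝ V) (g : LinearMap.BilinForm ℝ V) (hg : IsLorentzian g)
    (H : Submodule ℝ V) (hH : finrank ℝ H = finrank ℝ V - 1) (e : V) (he : e ≠ 0)
    (h : ∀ w ∈ H, g e w = 0) (w : V) : w ∈ H ↔ g e w = 0 := by
  have hne : g e ≠ 0 := fun h0 => he (lor_nondeg g hg e fun t => by rw [h0]; rfl)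
  have hk := Module.Dual.finrank_ker_add_one_of_ne_zero (f := g e) hne
  have : H = LinearMap.ker (g e) :=
    Submodule.eq_of_le_of_finrank_eq (fun w hw => h w hw) (by omega)
  rw [this]; rfl

/-- An algebraic Weyl-type tensor on a Lorentzian space of dimension `≥ 4` which vanishes on,
and has image inside, two *distinct* degenerate hyperplanes must vanish. -/
theorem weyl_tensor_two_degenerate_hyperplanes_zero {V : Type*} [AddCommGroup V] [Module ℝ V]
    [FiniteDimensional ℝ V] (hdim : 4 ≤ finrank ℝ V)
    (g : LinearMap.BilinForm ℝ V) (hsymm : g.IsSymm) (hg : IsLorentzian g)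
    (W : V →ₗ[ℝ] V →ₗ[ℝ] V →ₗ[ℝ] V)
    (hskew₁ : ∀ u v w t : V, g (W u v w) t = - g (W v u w) t)
    (hskew₂ : ∀ u v w t : V, g (W u v w) t = - g (W u v t) w)
    (hpair : ∀ u v w t : V, g (W u v w) t = g (W w t u) v)
    (hbianchi : ∀ u v w t : V, g (W u v w) t + g (W v w u) t + g (W w u v) t = 0)
    (H H' : Submodule ℝ V) (hne : H ≠ H')
    (hHhyp : finrank ℝ H = finrank ℝ V - 1)
    (hH'hyp : finrank ℝ H' = finrank ℝ V - 1)
    (hHdeg : ∃ e ∈ H, e ≠ 0 ∧ ∀ w ∈ H, g e w = 0)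
    (hH'deg : ∃ e ∈ H', e ≠ 0 ∧ ∀ w ∈ H', g e w = 0)
    (hHvan : ∀ u ∈ H, ∀ v ∈ H, ∀ w ∈ H, W u v w = 0)
    (hHim : ∀ u v w : V, W u v w ∈ H)
    (hH'van : ∀ u ∈ H', ∀ v ∈ H', ∀ w ∈ H', W u v w = 0)
    (hH'im : ∀ u v w : V, W u v w ∈ H') :
    W = 0 := by
  obtain ⟨e, heH, he, heo⟩ := hHdeg
  obtain ⟨f, hfH, hf, hfo⟩ := hH'deg
  have kH := hyp_eq_ker hdim g hg H hHhyp e he heo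
  have kH' := hyp_eq_ker hdim g hg H' hH'hyp f hf hfo
  have hef : g e f ≠ 0 := by
    intro hef
    have hfe : g f e = 0 := by rw [← hef]; exact hsymm.eq f e
    have hee := heo e heH
    have hff := hfo f hfH
    obtain ⟨b, hb⟩ := hg
    let z : Fin (finrank ℝ V) := ⟨0, by omega⟩
    have hz : ∀ i : Fin (finrank ℝ V), (i : ℕ) = 0 → i = z := fun i hi => Fin.ext hi
    have e0 : b.repr e z ≠ 0 := fun h0 =>
      he (lor_iso g b hb e hee fun i hi => by rw [hz i hi, h0])
    have f0 : b.repr f z ≠ 0 := fun h0 =>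
      hf (lor_iso g b hb f hff fun i hi => by rw [hz i hi, h0])
    have hx : b.repr f z • e - b.repr e z • f = 0 := by
      apply lor_iso g b hb
      · simp [hef, hfe, hee, hff]
      · intro i hi
        rw [hz i hi]
        simp [mul_comm]
    apply hne
    ext w
    rw [kH, kH']
    have hw : b.repr f z * g e w - b.repr e z * g f w = 0 := by
      have := congrArg (fun x => g x w) hx
      simpa using this
    constructor
    · intro h
      rw [h] at hw
      have : b.repr e z * g f w = 0 := by linarith
      exact (mul_eq_zero.1 this).resolve_left e0
    · intro h
      rw [h] at hw
      have : b.repr f z * g e w = 0 := by linarith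
      exact (mul_eq_zero.1 this).resolve_left f0
  have w3 : ∀ u v, W u v f = 0 := fun u v => lor_nondeg g hg _ fun t => by
    rw [hskew₂, show g (W u v t) f = g f (W u v t) from hsymm.eq _ _, hfo _ (hH'im u v t), neg_zero]
  have w1 : ∀ v w, W f v w = 0 := fun v w => lor_nondeg g hg _ fun t => by
    rw [hpair, w3]; simp
  have w2 : ∀ u w, W u f w = 0 := fun u w => lor_nondeg g hg _ fun t => by
    rw [hskew₁, w1]; simp
  have dec : ∀ v, ∃ h ∈ H, ∃ a : ℝ, v = h + a • f := fun v =>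
    ⟨v - (g e v / g e f) • f, by rw [kH]; simp [hef], g e v / g e f, by simp⟩
  ext u v w
  obtain ⟨u', hu, a, rfl⟩ := dec u
  obtain ⟨v', hv, c, rfl⟩ := dec v
  obtain ⟨w', hw, d, rfl⟩ := dec w
  simp [w1, w2, w3, hHvan u' hu v' hv w' hw]
end

section
/- Let n ≥ 3 and let A ∈ so(2,n) (with respect to the form Q) satisfy A e₁ ∈ ℝ e₁ (i.e. A ∈ p), and suppose A is diagonalizable over ℝ. Then there exists an invertible matrix p preserving Q and preserving the line ℝ e₁ (i.e. p ∈ P) such that p A p⁻¹ ∈ a. -/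
open Matrix

/-- The symmetric matrix `J'` of the quadratic form
`Q(x) = 2x₁x_{n+2} + 2x₂x_{n+1} + x₃² + ⋯ + x_n²` of signature `(2,n)` on `ℝ^{n+2}`
(indices `0, …, n+1`). -/
noncomputable def Jprime (n : ℕ) : Matrix (Fin (n + 2)) (Fin (n + 2)) ℝ := fun i j =>
  if (i : ℕ) + (j : ℕ) = n + 1 ∧ ((i : ℕ) ≤ 1 ∨ (j : ℕ) ≤ 1) then 1
  else if i = j ∧ 2 ≤ (i : ℕ) ∧ (i : ℕ) ≤ n - 1 then 1
  else 0

/-- The diagonal matrix `diag(λ, μ, 0, …, 0, -μ, -λ)` of the Cartan subspace `a ⊆ so(2,n)`. -/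
noncomputable def cartanDiag (n : ℕ) (l m : ℝ) : Matrix (Fin (n + 2)) (Fin (n + 2)) ℝ :=
  Matrix.diagonal (fun i =>
    if (i : ℕ) = 0 then l else if (i : ℕ) = 1 then m
    else if (i : ℕ) = n then -m else if (i : ℕ) = n + 1 then -l else 0)

section aux
variable {V : Type*} [AddCommGroup V] [Module ℝ V]

lemma aux_partner (B : LinearMap.BilinForm ℝ V) (A : V →ₗ[ℝ] V)
    (hs : ∀ x y, B x y = B y x) (hk : ∀ x y, B (A x) y = - B x (A y))
    (v g : V) (m k : ℝ) (hv : A v = m • v) (hvv : B v v = 0) (hg : A g = k • g)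
    (hvg : B v g ≠ 0) :
    ∃ a b : ℝ, A (a • g + b • v) = (-m) • (a • g + b • v) ∧
      B (a • g + b • v) (a • g + b • v) = 0 ∧ B v (a • g + b • v) = 1 := by
  have h1 : k = -m := by
    have := hk v g
    rw [hv, hg] at this
    simp at this
    have h2 : (m + k) * B v g = 0 := by linarith
    rcases mul_eq_zero.1 h2 with h | h
    · linarith
    · exact absurd h hvg
  subst h1
  have h3 : m * B g g = 0 := by
    have := hk g g
    rw [hg] at this
    simp at this
    linarith
  have hgv : B g v = B v g := hs _ _
  refine ⟨(B v g)⁻¹, -((B v g)⁻¹ * B g g / (2 * B v g)), ?_, ?_, ?_⟩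
  · rcases mul_eq_zero.1 h3 with h | h
    · subst h
      simp [hg, hv]
    · simp [h, hg, smul_smul]
      ring_nf
  · simp [hvv, hgv]
    field_simp
    ring
  · simp [hvv]
    field_simp

lemma aux_onb [FiniteDimensional ℝ V] (B : LinearMap.BilinForm ℝ V)
    (hs : ∀ x y, B x y = B y x) (hp : ∀ x, B x x ≤ 0 → x = 0) (d : ℕ)
    (hd : Module.finrank ℝ V = d) :
    ∃ x : Fin d → V, ∀ i j, B (x i) (x j) = if i = j then 1 else 0 := by
  subst hd
  obtain ⟨b, hb⟩ := LinearMap.BilinForm.exists_orthogonal_basis (B := B) ⟨fun x y => by simpa using hs x y⟩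
  have hpos : ∀ i, 0 < B (b i) (b i) := fun i => by
    by_contra h
    exact b.ne_zero i (hp _ (not_lt.1 h))
  refine ⟨fun i => (Real.sqrt (B (b i) (b i)))⁻¹ • b i, fun i j => ?_⟩
  split_ifs with h
  · subst h
    have h2 := Real.mul_self_sqrt (hpos i).le
    have h3 := (Real.sqrt_pos.2 (hpos i)).ne'
    simp only [map_smul, LinearMap.smul_apply, smul_eq_mul]
    field_simp
    nlinarith
  · have := hb h
    simp only [Function.onFun] at this
    simp [this]

lemma aux_main [FiniteDimensional ℝ V] (n : ℕ) (hV : Module.finrank ℝ V = n + 2)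
    (B : LinearMap.BilinForm ℝ V) (A : V →ₗ[ℝ] V)
    (hs : ∀ x y, B x y = B y x) (hk : ∀ x y, B (A x) y = - B x (A y))
    (hnd : ∀ x, (∀ y, B x y = 0) → x = 0)
    {ι : Type*} (P : ι → V) (κ : ι → ℝ) (hP : Submodule.span ℝ (Set.range P) = ⊤)
    (hPA : ∀ i, A (P i) = κ i • P i)
    (e e₂ e₃ : V) (l : ℝ) (he : A e = l • e) (he0 : e ≠ 0) (hee : B e e = 0)
    (h22 : B e₂ e₂ = 0) (h12 : B e e₂ = 0) (h23 : B e₂ e₃ = 1) (h13 : B e e₃ = 0)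
    (φ : V →ₗ[ℝ] (Fin 2 → ℝ)) (hφ : ∀ x, φ x = 0 → B x x ≤ 0 → x = 0) :
    ∃ (v w f : V) (m : ℝ) (x : Fin (n - 2) → V),
      A f = (-l) • f ∧ A v = m • v ∧ A w = (-m) • w ∧ (∀ i, A (x i) = 0) ∧
      B e f = 1 ∧ B v w = 1 ∧ B f f = 0 ∧ B v v = 0 ∧ B w w = 0 ∧
      B e v = 0 ∧ B e w = 0 ∧ B f v = 0 ∧ B f w = 0 ∧
      (∀ i, B (x i) e = 0 ∧ B (x i) v = 0 ∧ B (x i) w = 0 ∧ B (x i) f = 0) ∧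
      ∀ i j, B (x i) (x j) = if i = j then 1 else 0 := by
  have hpair : ∀ v, v ≠ 0 → ∃ i, B v (P i) ≠ 0 := by
    intro v hv
    by_contra! h
    have h0 : B v = 0 := LinearMap.ext_on_range (v := P) hP (by simpa using h)
    exact hv (hnd v fun y => by rw [h0]; rfl)
  obtain ⟨i, hi⟩ := hpair e he0
  obtain ⟨a, b, hf1, hf2, hf3⟩ := aux_partner B A hs hk e (P i) l (κ i) he hee (hPA i) hi
  generalize a • P i + b • e = f at hf1 hf2 hf3
  have hfe : B f e = 1 := by rw [hs, hf3]
  -- projection to the complement of e, f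
  let π : V →ₗ[ℝ] V := LinearMap.id - (B f).smulRight e - (B e).smulRight f
  have hπ : ∀ x, π x = x - B f x • e - B e x • f := fun x => by simp [π]
  have hπA : ∀ x, A (π x) = π (A x) := by
    intro x
    have h1 := hk f x
    have h2 := hk e x
    rw [hf1] at h1
    rw [he] at h2
    simp at h1 h2
    rw [hπ, hπ, ← neg_eq_iff_eq_neg.2 h2, ← h1]
    simp only [map_sub, map_smul, he, hf1]
    module
  have hπe : ∀ x, B e (π x) = 0 := fun x => by rw [hπ]; simp [hee, hf3]
  have hπf : ∀ x, B f (π x) = 0 := fun x => by rw [hπ]; simp [hf2, hfe]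
  have hv : ∃ (v : V) (m : ℝ), A v = m • v ∧ v ≠ 0 ∧ B v v = 0 ∧ B e v = 0 ∧ B f v = 0 := by
    by_cases hc : ∀ i, κ i • π (P i) = 0
    · have h0 : A ∘ₗ π = 0 := LinearMap.ext_on_range (v := P) hP (by
        intro i; simp [hπA, hPA, hc])
      have hz : ∀ x, A (π x) = 0 := fun x => by
        have := LinearMap.congr_fun h0 x
        simpa using this
      refine ⟨π e₂, 0, by simp [hz], ?_, ?_, hπe _, hπf _⟩
      · intro h
        have : B (π e₂) e₃ = 1 := by rw [hπ]; simp [h12, h23, h13]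
        rw [h] at this
        simp at this
      · rw [hπ]
        have : B e₂ e = 0 := by rw [hs, h12]
        simp [h12, h22, this, hee]
    · push Not at hc
      obtain ⟨j, hj⟩ := hc
      have h1 : A (π (P j)) = κ j • π (P j) := by rw [hπA, hPA]; simp
      have hk0 : κ j ≠ 0 := fun h => hj (by simp [h])
      refine ⟨π (P j), κ j, h1, fun h => hj (by simp [h]), ?_, hπe _, hπf _⟩
      have := hk (π (P j)) (π (P j))
      rw [h1] at this
      simp at this
      have h2 : κ j * B (π (P j)) (π (P j)) = 0 := by linarith
      exact (mul_eq_zero.1 h2).resolve_left hk0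
  obtain ⟨v, m, hv1, hv0, hvv, hev, hfv⟩ := hv
  have hve : B v e = 0 := by rw [hs, hev]
  have hvf : B v f = 0 := by rw [hs, hfv]
  obtain ⟨j, hj⟩ := hpair v hv0
  obtain ⟨a', b', hw1, hw2, hw3⟩ := aux_partner B A hs hk v (π (P j)) m (κ j) hv1 hvv
    (by rw [hπA, hPA]; simp) (by rw [hπ]; simpa [hve, hvf] using hj)
  have hew : B e (a' • π (P j) + b' • v) = 0 := by simp [hπe, hev]
  have hfw : B f (a' • π (P j) + b' • v) = 0 := by simp [hπf, hfv]
  generalize a' • π (P j) + b' • v = w at hw1 hw2 hw3 hew hfw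
  have hwv : B w v = 1 := by rw [hs, hw3]
  have hwe : B w e = 0 := by rw [hs, hew]
  have hwf : B w f = 0 := by rw [hs, hfw]
  -- the complement
  let ψ : V →ₗ[ℝ] (Fin 4 → ℝ) := LinearMap.pi ![B e, B v, B w, B f]
  have hψ : ∀ x, x ∈ LinearMap.ker ψ ↔ B e x = 0 ∧ B v x = 0 ∧ B w x = 0 ∧ B f x = 0 := by
    intro x
    rw [LinearMap.mem_ker, funext_iff]
    simp [ψ, Fin.forall_fin_succ]
  have hsurj : LinearMap.range ψ = ⊤ := by
    rw [LinearMap.range_eq_top]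
    intro c
    refine ⟨c 0 • f + c 1 • w + c 2 • v + c 3 • e, ?_⟩
    ext t
    fin_cases t <;> simp [ψ, hee, hev, hew, hf3, hve, hvv, hw3, hvf, hwe, hwv, hw2, hwf, hfe, hfv, hfw, hf2]
  have hdim : Module.finrank ℝ (LinearMap.ker ψ) = n - 2 := by
    have := LinearMap.finrank_range_add_finrank_ker ψ
    rw [hsurj, hV] at this
    simp at this
    omega
  have hpos : ∀ x ∈ LinearMap.ker ψ, B x x ≤ 0 → x = 0 := by
    intro x hx hxx
    obtain ⟨hx1, hx2, hx3, hx4⟩ := (hψ x).1 hx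
    have hx1' : B x e = 0 := by rw [hs, hx1]
    have hx2' : B x v = 0 := by rw [hs, hx2]
    let L : (Fin 3 → ℝ) →ₗ[ℝ] V := Fintype.linearCombination ℝ ![e, v, x]
    have hL : ∀ c, L c = c 0 • e + c 1 • v + c 2 • x := by
      intro c; simp [L, Fintype.linearCombination_apply, Fin.sum_univ_three]
    have hker : LinearMap.ker (φ ∘ₗ L) ≠ ⊥ := LinearMap.ker_ne_bot_of_finrank_lt (by simp)
    obtain ⟨c, hc, hc0⟩ := (Submodule.ne_bot_iff _).1 hker
    have h0 : L c = 0 := by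
      apply hφ
      · simpa using hc
      · rw [hL]
        simp [hee, hvv, hev, hve, hx1, hx2, hx1', hx2']
        nlinarith [mul_self_nonneg (c 2)]
    rw [hL] at h0
    have ha : c 0 = 0 := by
      have := congrArg (B f) h0
      simpa [hfe, hfv, hx4] using this
    have hb : c 1 = 0 := by
      have := congrArg (B w) h0
      simpa [hwe, hwv, hx3] using this
    have hc2 : c 2 ≠ 0 := by
      intro h
      apply hc0
      ext t
      fin_cases t <;> simp [ha, hb, h]
    simpa [ha, hb, hc2] using h0
  obtain ⟨x, hx⟩ := aux_onb (V := LinearMap.ker ψ) (B.restrict (LinearMap.ker ψ))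
    (fun x y => hs _ _) (fun x h => Subtype.ext (hpos x x.2 h)) (n - 2) hdim
  -- A vanishes on the complement
  let ρ : V →ₗ[ℝ] V := LinearMap.id - (B f).smulRight e - (B e).smulRight f
    - (B w).smulRight v - (B v).smulRight w
  have hρ : ∀ x, ρ x = x - B f x • e - B e x • f - B w x • v - B v x • w := fun x => by simp [ρ]
  have hρA : ∀ x, A (ρ x) = ρ (A x) := by
    intro x
    have h1 := hk f x
    have h2 := hk e x
    have h3 := hk v x
    have h4 := hk w x
    rw [hf1] at h1
    rw [he] at h2
    rw [hv1] at h3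
    rw [hw1] at h4
    simp at h1 h2 h3 h4
    rw [hρ, hρ, ← neg_eq_iff_eq_neg.2 h2, ← h1, ← h4, ← neg_eq_iff_eq_neg.2 h3]
    simp only [map_sub, map_smul, he, hf1, hv1, hw1]
    module
  have hρm : ∀ x, ρ x ∈ LinearMap.ker ψ := by
    intro x
    rw [hψ, hρ]
    simp [hee, hev, hew, hf3, hve, hvv, hw3, hvf, hwe, hwv, hw2, hwf, hfe, hfv, hfw, hf2]
  have hz0 : A ∘ₗ ρ = 0 := LinearMap.ext_on_range (v := P) hP (by
    intro i
    have h1 : A (ρ (P i)) = κ i • ρ (P i) := by rw [hρA, hPA]; simp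
    have := hk (ρ (P i)) (ρ (P i))
    rw [h1] at this
    simp at this
    have h2 : κ i * B (ρ (P i)) (ρ (P i)) = 0 := by linarith
    simp only [LinearMap.comp_apply, h1, LinearMap.zero_apply]
    rcases mul_eq_zero.1 h2 with h | h
    · simp [h]
    · simp [hpos _ (hρm _) h.le])
  have hx' : ∀ i, B e (x i) = 0 ∧ B v (x i) = 0 ∧ B w (x i) = 0 ∧ B f (x i) = 0 :=
    fun i => (hψ _).1 (x i).2
  refine ⟨v, w, f, m, fun i => x i, hf1, hv1, hw1, ?_, hf3, hw3, hf2, hvv, hw2, hev, hew, hfv, hfw,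
    ?_, fun i j => hx i j⟩
  · intro i
    have h1 : ρ (x i) = x i := by
      obtain ⟨h1, h2, h3, h4⟩ := hx' i
      rw [hρ, h1, h2, h3, h4]; simp
    have := LinearMap.congr_fun hz0 (x i)
    rw [LinearMap.comp_apply, h1] at this
    simpa using this
  · intro i
    obtain ⟨h1, h2, h3, h4⟩ := hx' i
    exact ⟨by rw [hs, h1], by rw [hs, h2], by rw [hs, h3], by rw [hs, h4]⟩

end aux

def auxTau (n : ℕ) (i : Fin (n + 2)) : Fin (n + 2) :=
  if (i : ℕ) ≤ 1 ∨ n ≤ (i : ℕ) then Fin.rev i else i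

lemma auxTau_tau (n : ℕ) (i : Fin (n + 2)) : auxTau n (auxTau n i) = i := by
  unfold auxTau
  ext
  split_ifs <;> simp_all [Fin.val_rev] <;> omega

lemma aux_J (n : ℕ) (hn : 3 ≤ n) (i j : Fin (n + 2)) :
    Jprime n i j = if auxTau n i = j then 1 else 0 := by
  unfold Jprime auxTau
  simp only [Fin.ext_iff]
  have := i.2
  have := j.2
  split_ifs <;> simp_all [Fin.val_rev] <;> omega

lemma aux_Jmul (n : ℕ) (hn : 3 ≤ n) (y : Fin (n + 2) → ℝ) (i : Fin (n + 2)) :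
    (Jprime n *ᵥ y) i = y (auxTau n i) := by
  simp [Matrix.mulVec, dotProduct, aux_J n hn]

lemma aux_JT (n : ℕ) (hn : 3 ≤ n) : (Jprime n)ᵀ = Jprime n := by
  ext i j
  rw [Matrix.transpose_apply, aux_J n hn, aux_J n hn]
  congr 1
  apply propext
  constructor <;> (rintro rfl; exact auxTau_tau n _)

lemma aux_JJ (n : ℕ) (hn : 3 ≤ n) : Jprime n * Jprime n = 1 := by
  ext i j
  have h := aux_Jmul n hn (fun k => Jprime n k j) i
  have h2 : (Jprime n * Jprime n) i j = (Jprime n *ᵥ (fun k => Jprime n k j)) i := rfl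
  rw [h2, h, aux_J n hn, auxTau_tau, Matrix.one_apply]

/-- Any `ℝ`-diagonalizable element `A ∈ so(2,n)` stabilizing the isotropic line `ℝe₁`
(i.e. `A ∈ p`) is conjugate, by an element `p ∈ P` of the orthogonal group of `Q`
stabilizing the line `ℝe₁`, to an element of the Cartan subspace `a` of diagonal matrices
`diag(λ, μ, 0, …, 0, -μ, -λ)`. -/
theorem split_element_of_p_conjugate_into_cartan_within_P (n : ℕ) (hn : 3 ≤ n)
    (A : Matrix (Fin (n + 2)) (Fin (n + 2)) ℝ)
    (hA : Aᵀ * Jprime n + Jprime n * A = 0)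
    (hAe : ∃ μ : ℝ, A.mulVec (Pi.single 0 1) = μ • (Pi.single 0 1 : Fin (n + 2) → ℝ))
    (hAdiag : ∃ (P : Matrix (Fin (n + 2)) (Fin (n + 2)) ℝ) (lam : Fin (n + 2) → ℝ),
      IsUnit P.det ∧ A = P * Matrix.diagonal lam * P⁻¹) :
    ∃ p : Matrix (Fin (n + 2)) (Fin (n + 2)) ℝ,
      pᵀ * Jprime n * p = Jprime n ∧
      (∃ c : ℝ, p.mulVec (Pi.single 0 1) = c • (Pi.single 0 1 : Fin (n + 2) → ℝ)) ∧
      ∃ l m : ℝ, p * A * p⁻¹ = cartanDiag n l m := by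
  obtain ⟨l, hl⟩ := hAe
  obtain ⟨P, κ, hPu, hPA⟩ := hAdiag
  let B : LinearMap.BilinForm ℝ (Fin (n + 2) → ℝ) := Matrix.toBilin' (Jprime n)
  have hB : ∀ x y, B x y = x ⬝ᵥ (Jprime n *ᵥ y) := fun x y => Matrix.toBilin'_apply' _ _ _
  clear_value B
  have hB2 : ∀ x y, B x y = ∑ i, x i * y (auxTau n i) := fun x y => by
    rw [hB]; simp only [dotProduct, aux_Jmul n hn]
  have hBe : ∀ i y, B (Pi.single i 1) y = y (auxTau n i) := by
    intro i y
    rw [hB2]; simp [Pi.single_apply]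
  have hs : ∀ x y, B x y = B y x := by
    intro x y
    rw [hB, hB, dotProduct_mulVec, ← mulVec_transpose, aux_JT n hn, dotProduct_comm]
  have hk : ∀ x y, B (Matrix.toLin' A x) y = - B x (Matrix.toLin' A y) := by
    intro x y
    rw [hB, hB, Matrix.toLin'_apply, Matrix.toLin'_apply, mulVec_mulVec, dotProduct_comm,
      dotProduct_mulVec, ← mulVec_transpose, mulVec_mulVec, dotProduct_comm,
      eq_neg_of_add_eq_zero_left hA |> fun h => h, neg_mulVec, dotProduct_neg]
  have hPAcol : A * P = P * Matrix.diagonal κ := by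
    rw [hPA, Matrix.mul_assoc, Matrix.nonsing_inv_mul _ hPu, Matrix.mul_one]
  have hcol : ∀ i, A *ᵥ (P.col i) = κ i • P.col i := by
    intro i
    ext t
    have := congrFun (congrFun hPAcol t) i
    rw [Matrix.mul_diagonal] at this
    simp only [Pi.smul_apply, smul_eq_mul, Matrix.col_apply]
    rw [mul_comm, ← this]
    rfl
  have h0 : (0 : Fin (n + 2)) ≠ 1 := by simp
  have t0 : auxTau n 0 = Fin.last (n + 1) := by simp [auxTau]
  have t1 : ((auxTau n 1 : Fin (n + 2)) : ℕ) = n := by simp [auxTau, Fin.val_rev]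
  have hspan : Submodule.span ℝ (Set.range P.col) = ⊤ := by
    rw [← Matrix.range_mulVecLin, LinearMap.range_eq_top]
    exact Matrix.mulVec_surjective_iff_isUnit.2 ((Matrix.isUnit_iff_isUnit_det _).2 hPu)
  let φ : (Fin (n + 2) → ℝ) →ₗ[ℝ] (Fin 2 → ℝ) :=
    { toFun := fun x => ![x 0 - x (auxTau n 0), x 1 - x (auxTau n 1)]
      map_add' := fun x y => by ext t; fin_cases t <;> simp <;> ring
      map_smul' := fun c x => by ext t; fin_cases t <;> simp <;> ring }
  obtain ⟨v, w, f, m, x, hf, hv, hw, hx, hef, hvw, hff, hvv, hww, hev, hew, hfv, hfw, hxx, hxo⟩ :=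
    aux_main n (by simp) B (Matrix.toLin' A) hs hk
    (fun x h => by
      ext i
      have := h (Pi.single (auxTau n i) 1)
      rw [hs, hBe, auxTau_tau] at this
      exact this)
    P.col κ hspan (by simpa using hcol)
    (Pi.single 0 1) (Pi.single 1 1) (Pi.single (auxTau n 1) 1) l (by simpa using hl)
    (by simp)
    (by rw [hBe, t0]; simp [Fin.ext_iff])
    (by rw [hBe, Pi.single_apply, if_neg]; rw [Fin.ext_iff, t1]; simp; omega)
    (by rw [hBe, t0, Pi.single_apply, if_neg]; rw [Fin.ext_iff, Fin.val_last, Fin.val_one]; omega)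
    (by rw [hBe]; simp)
    (by rw [hBe, t0, Pi.single_apply, if_neg]; rw [Fin.ext_iff, t1]; simp)
    φ
    (by
      intro x hx hxx
      have hx0 : x (auxTau n 0) = x 0 := by
        have : x 0 - x (auxTau n 0) = 0 := congrFun hx 0
        linarith
      have hx1 : x (auxTau n 1) = x 1 := by
        have : x 1 - x (auxTau n 1) = 0 := congrFun hx 1
        linarith
      have hfix : ∀ i, x (auxTau n i) = x i := by
        intro i
        by_cases h : i = 0
        · rw [h, hx0]
        by_cases h' : i = 1
        · rw [h', hx1]
        by_cases h2 : i = auxTau n 0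
        · rw [h2, auxTau_tau, hx0]
        by_cases h3 : i = auxTau n 1
        · rw [h3, auxTau_tau, hx1]
        congr 1
        rw [Fin.ext_iff] at h h' h2 h3
        rw [t0] at h2
        rw [t1] at h3
        simp only [Fin.val_zero, Fin.val_one, Fin.val_last] at h h' h2
        unfold auxTau
        have := i.2
        rw [if_neg]
        omega
      rw [hB2] at hxx
      simp only [hfix] at hxx
      have hz := (Finset.sum_eq_zero_iff_of_nonneg (fun i _ => mul_self_nonneg (x i))).1
        (le_antisymm hxx (Finset.sum_nonneg fun i _ => mul_self_nonneg (x i)))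
      ext i
      simpa using hz i (Finset.mem_univ i))
  simp only [Matrix.toLin'_apply] at hf hv hw hx
  let u : Fin (n + 2) → (Fin (n + 2) → ℝ) := fun i =>
    if (i : ℕ) = 0 then Pi.single 0 1 else if (i : ℕ) = 1 then v
    else if (i : ℕ) = n then w else if h : (i : ℕ) < n ∧ 2 ≤ (i : ℕ) then x ⟨i - 2, by omega⟩ else f
  have hee : B (Pi.single 0 1) (Pi.single 0 1) = 0 := by rw [hBe, t0]; simp [Fin.ext_iff]
  let M : Matrix (Fin (n + 2)) (Fin (n + 2)) ℝ := fun i j => u j i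
  have hMJ : Mᵀ * Jprime n * M = Jprime n := by
    ext i j
    have h1 : (Mᵀ * Jprime n * M) i j = B (u i) (u j) := by
      rw [hB, Matrix.mul_assoc]
      rfl
    rw [h1]
    have hi := i.2
    have hj := j.2
    have hxe := fun a => (hxx a).1
    have hxv := fun a => (hxx a).2.1
    have hxw := fun a => (hxx a).2.2.1
    have hxf := fun a => (hxx a).2.2.2
    have hex := fun a => (hs _ _).trans (hxe a)
    have hvx := fun a => (hs _ _).trans (hxv a)
    have hwx := fun a => (hs _ _).trans (hxw a)
    have hfx := fun a => (hs _ _).trans (hxf a)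
    have hfe := (hs _ _).trans hef
    have hwv := (hs _ _).trans hvw
    have hve := (hs _ _).trans hev
    have hwe := (hs _ _).trans hew
    have hvf := (hs _ _).trans hfv
    have hwf := (hs _ _).trans hfw
    simp only [u, Jprime, Fin.ext_iff]
    split_ifs <;> first
      | omega
      | exact hee
      | exact hef
      | exact hev
      | exact hew
      | exact hfe
      | exact hff
      | exact hfv
      | exact hfw
      | exact hve
      | exact hvf
      | exact hvv
      | exact hvw
      | exact hwe
      | exact hwf
      | exact hwv
      | exact hww
      | exact hex _
      | exact hvx _
      | exact hwx _
      | exact hfx _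
      | exact hxe _
      | exact hxv _
      | exact hxw _
      | exact hxf _
      | (rw [hxo]; simp only [Fin.ext_iff]; split_ifs <;> first | rfl | omega)
  have hAM : A * M = M * cartanDiag n l m := by
    ext i j
    have h1 : (A * M) i j = (A *ᵥ u j) i := rfl
    rw [h1, cartanDiag, Matrix.mul_diagonal]
    have hj := j.2
    simp only [M, u]
    split_ifs <;> first
      | omega
      | (simp only [hl, hf, hv, hw, hx, Pi.smul_apply, smul_eq_mul, Pi.zero_apply]; ring)
  have hleft : (Jprime n * Mᵀ * Jprime n) * M = 1 := by
    rw [Matrix.mul_assoc, Matrix.mul_assoc, ← Matrix.mul_assoc Mᵀ, hMJ, aux_JJ n hn]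
  have hdet : IsUnit M.det := Matrix.isUnit_det_of_left_inverse hleft
  have hMi : M * M⁻¹ = 1 := Matrix.mul_nonsing_inv _ hdet
  have hiM : M⁻¹ * M = 1 := Matrix.nonsing_inv_mul _ hdet
  refine ⟨M⁻¹, ?_, ⟨1, ?_⟩, l, m, ?_⟩
  · have hT : (M⁻¹)ᵀ * Mᵀ = 1 := by rw [← Matrix.transpose_mul, hMi, Matrix.transpose_one]
    calc (M⁻¹)ᵀ * Jprime n * M⁻¹ = (M⁻¹)ᵀ * (Mᵀ * Jprime n * M) * M⁻¹ := by rw [hMJ]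
      _ = ((M⁻¹)ᵀ * Mᵀ) * Jprime n * (M * M⁻¹) := by simp only [Matrix.mul_assoc]
      _ = Jprime n := by rw [hT, hMi, Matrix.one_mul, Matrix.mul_one]
  · have : M *ᵥ (Pi.single 0 1) = Pi.single 0 1 := by
      ext i
      rw [Matrix.mulVec_single_one]
      rfl
    rw [one_smul]
    conv_lhs => rw [← this]
    rw [mulVec_mulVec, hiM, one_mulVec]
  · rw [Matrix.nonsing_inv_nonsing_inv _ hdet, Matrix.mul_assoc, hAM, ← Matrix.mul_assoc, hiM,
      Matrix.one_mul]
end
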